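/- Let n be a positive integer that is not squarefree. Then a(0,n) = 1, and the triple (a(1,n), a(2,n), a(3,n)) takes exactly one of the following five values: (0,1,0), (0,0,1), (0,0,0), (0,0,-1), (0,-1,0). In particular a(1,n) = 0. -/

import Mathlib

/-- The coefficient `a(j,n)` of `z^(φ(n)-j)` in the `n`-th cyclotomic polynomial,
with `a(j,n) = 0` for `j > φ(n)`. -/
noncomputable def cycCoeff (j n : ℕ) : ℤ :=
  if j ≤ n.totient then (Polynomial.cyclotomic n ℤ).coeff (n.totient - j) else 0

open Polynomial

theorem cycCoeff_zero (n : ℕ) : cycCoeff 0 n = 1 := by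
  have h := (cyclotomic.monic n ℤ).coeff_natDegree
  rw [natDegree_cyclotomic] at h
  simpa [cycCoeff] using h

theorem cycCoeff_one_eq_nextCoeff (n : ℕ) : cycCoeff 1 n = (cyclotomic n ℤ).nextCoeff := by
  rw [cycCoeff, nextCoeff, natDegree_cyclotomic]
  split_ifs <;> first | rfl | omega

theorem cycCoeff_prime_mul {p m : ℕ} (hp : p.Prime) (hpm : p ∣ m) (j : ℕ) :
    cycCoeff j (p * m) = if p ∣ j then cycCoeff (j / p) m else 0 := by
  have ht : (p * m).totient = p * m.totient := Nat.totient_mul_of_prime_of_dvd hp hpm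
  rw [cycCoeff, ht, mul_comm p m, ← cyclotomic_expand_eq_cyclotomic hp hpm ℤ]
  split_ifs with hj hpj hpj
  · obtain ⟨i, rfl⟩ := hpj
    rw [Nat.mul_div_cancel_left _ hp.pos, cycCoeff,
      if_pos (Nat.le_of_mul_le_mul_left hj hp.pos), ← Nat.mul_sub,
      coeff_expand_mul' hp.pos]
  · rw [coeff_expand hp.pos, if_neg]
    exact fun h => hpj ((Nat.dvd_sub_iff_right hj (dvd_mul_right _ _)).1 h)
  · obtain ⟨i, rfl⟩ := hpj
    rw [Nat.mul_div_cancel_left _ hp.pos, cycCoeff,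
      if_neg fun h => hj (Nat.mul_le_mul_left p h)]
  · rfl

theorem nextCoeff_expand_eq_zero {R : Type*} [CommRing R] {p : ℕ} (hp : 1 < p) (f : R[X]) :
    (expand R p f).nextCoeff = 0 := by
  rw [nextCoeff, natDegree_expand]
  split_ifs with h
  · rfl
  · rw [coeff_expand (by omega), if_neg]
    intro hd
    have := (Nat.dvd_sub_iff_right (Nat.one_le_iff_ne_zero.2 h) (dvd_mul_left p _)).1 hd
    exact hp.ne' (Nat.dvd_one.1 this)

theorem cycCoeff_one_mem {n : ℕ} (hn : 0 < n) :
    cycCoeff 1 n = -1 ∨ cycCoeff 1 n = 0 ∨ cycCoeff 1 n = 1 := by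
  induction n using induction_on_primes with
  | zero => omega
  | one =>
    left
    rw [cycCoeff_one_eq_nextCoeff, cyclotomic_one, ← C_1, nextCoeff_X_sub_C]
  | prime_mul p m hp ih =>
    have hm : 0 < m := Nat.pos_of_mul_pos_left hn
    by_cases hpm : p ∣ m
    · rw [cycCoeff_prime_mul hp hpm, if_neg hp.not_dvd_one]
      simp
    · have h := congrArg nextCoeff (cyclotomic_expand_eq_cyclotomic_mul hp hpm ℤ)
      rw [nextCoeff_expand_eq_zero hp.one_lt,
        (cyclotomic.monic _ ℤ).nextCoeff_mul (cyclotomic.monic _ ℤ),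
        ← cycCoeff_one_eq_nextCoeff, ← cycCoeff_one_eq_nextCoeff, mul_comm m p] at h
      have := ih hm
      omega

theorem cyclotomic_leading_coeffs_not_squarefree (n : ℕ) (hn : 0 < n)
    (hsf : ¬ Squarefree n) :
    cycCoeff 0 n = 1 ∧
    (cycCoeff 1 n, cycCoeff 2 n, cycCoeff 3 n) ∈
      ({(0, 1, 0), (0, 0, 1), (0, 0, 0), (0, 0, -1), (0, -1, 0)} : Set (ℤ × ℤ × ℤ)) ∧
    cycCoeff 1 n = 0 := by
  rw [Nat.squarefree_iff_prime_squarefree] at hsf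
  push Not at hsf
  obtain ⟨p, hp, k, rfl⟩ := hsf
  rw [mul_assoc] at hn ⊢
  have hpm : p ∣ p * k := dvd_mul_right p k
  have h1 : cycCoeff 1 (p * (p * k)) = 0 := by
    rw [cycCoeff_prime_mul hp hpm, if_neg hp.not_dvd_one]
  refine ⟨cycCoeff_zero _, ?_, h1⟩
  have hc := cycCoeff_one_mem (Nat.pos_of_mul_pos_left hn)
  rw [h1, cycCoeff_prime_mul hp hpm, cycCoeff_prime_mul hp hpm]
  simp only [Nat.prime_dvd_prime_iff_eq hp Nat.prime_two,
    Nat.prime_dvd_prime_iff_eq hp Nat.prime_three]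
  by_cases h2 : p = 2
  · subst h2
    rcases hc with hc | hc | hc <;> simp [hc]
  · by_cases h3 : p = 3
    · subst h3
      rcases hc with hc | hc | hc <;> simp [hc]
    · simp [h2, h3]
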